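/- Let S be a nonnegative real m×n matrix that is not identically zero, and let D be an m×m diagonal matrix with strictly positive diagonal entries. Then hsb(D·S) ≤ hsb(S) · (‖D‖ · ‖S‖) / ‖D·S‖. -/

import Mathlib

open scoped Classical
open Matrix BigOperators

/-- The Frobenius inner product of two real matrices. -/
def frob {m n : Type*} [Fintype m] [Fintype n] (A B : Matrix m n ℝ) : ℝ :=
  ∑ i, ∑ j, A i j * B i j

/-- The maximum absolute value of an entry of a real matrix. -/
noncomputable def mnorm {m n : Type*} [Fintype m] [Fintype n] (S : Matrix m n ℝ) : ℝ :=
  ⨆ p : m × n, |S p.1 p.2|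

/-- The finite set `R_{m,n}` of rank-one 0/1 matrices. -/
noncomputable def rankOne01 (m n : Type*) [Fintype m] [Fintype n] :
    Finset (Matrix m n ℝ) :=
  ((Finset.univ : Finset (Matrix m n Bool)).image
      (fun B => Matrix.of fun i j => if B i j then (1 : ℝ) else 0)).filter
    (fun R => R.rank = 1)

/-- The hyperplane separation bound
`hsb S = ‖S‖⁻¹ ⬝ sup { ⟨S,X⟩ : ⟨X,R⟩ ≤ 1 for all rank-one 0/1 matrices R }`. -/
noncomputable def hsb {m n : Type*} [Fintype m] [Fintype n] (S : Matrix m n ℝ) : ℝ :=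
  (mnorm S)⁻¹ *
    sSup {t : ℝ | ∃ X : Matrix m n ℝ,
      (∀ R ∈ rankOne01 m n, frob X R ≤ 1) ∧ t = frob S X}

lemma frob_diagonal_mul {m n : Type*} [Fintype m] [Fintype n] [DecidableEq m] (d : m → ℝ)
    (A B : Matrix m n ℝ) :
    frob (Matrix.diagonal d * A) B = frob A (Matrix.diagonal d * B) := by
  simp only [frob, Matrix.diagonal_mul]
  exact Finset.sum_congr rfl fun i _ => Finset.sum_congr rfl fun j _ => by ring

lemma mem_rankOne01 {m n : Type*} [Fintype m] [Fintype n] {R : Matrix m n ℝ} :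
    R ∈ rankOne01 m n ↔ (∀ i j, R i j = 0 ∨ R i j = 1) ∧ R.rank = 1 := by
  simp only [rankOne01, Finset.mem_filter, Finset.mem_image, Finset.mem_univ, true_and]
  refine and_congr_left fun _ => ⟨?_, fun h => ⟨fun i j => decide (R i j = 1), ?_⟩⟩
  · rintro ⟨B, rfl⟩ i j
    by_cases hB : B i j <;> simp [hB]
  · ext i j
    rcases h i j with h | h <;> simp [h]

lemma eq_zero_of_rank_eq_zero {m n : Type*} [Finite m] [Fintype n] {A : Matrix m n ℝ}
    (h : A.rank = 0) : A = 0 := by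
  rw [Matrix.rank, Submodule.finrank_eq_zero, LinearMap.range_eq_bot] at h
  ext i j
  simpa using congrFun (congrArg (fun f => f (Pi.single j 1)) h) i

lemma single_mem_rankOne01 {m n : Type*} [Fintype m] [Fintype n] [DecidableEq m] [DecidableEq n]
    (i : m) (j : n) :
    Matrix.single i j (1 : ℝ) ∈ rankOne01 m n := by
  refine mem_rankOne01.2 ⟨fun a b => ?_, le_antisymm ?_ ?_⟩
  · rw [Matrix.single_apply]
    split_ifs <;> simp
  · rw [Matrix.single_eq_single_vecMulVec_single]
    exact Matrix.rank_vecMulVec_le _ _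
  · refine Nat.one_le_iff_ne_zero.2 fun h => ?_
    have := congrFun (congrFun (eq_zero_of_rank_eq_zero h) i) j
    simp at this

/-- The matrices `X` with `⟨X,R⟩ ≤ 1` for all rank-one 0/1 matrices `R` are preserved
by scaling rows with factors in `[0,1]`. -/
lemma frob_diagonal_mul_le_one {m n : Type*} [Fintype m] [Fintype n] [DecidableEq m]
    {X : Matrix m n ℝ}
    (hX : ∀ R ∈ rankOne01 m n, frob X R ≤ 1) {c : m → ℝ} (hc0 : ∀ i, 0 ≤ c i)
    (hc1 : ∀ i, c i ≤ 1) {R : Matrix m n ℝ} (hR : R ∈ rankOne01 m n) :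
    frob (Matrix.diagonal c * X) R ≤ 1 := by
  set e : m → ℝ := fun i => if 0 < ∑ j, X i j * R i j then 1 else 0 with he
  have hle : frob (Matrix.diagonal c * X) R ≤ frob X (Matrix.diagonal e * R) := by
    rw [← frob_diagonal_mul]
    simp only [frob, Matrix.diagonal_mul, mul_assoc, ← Finset.mul_sum]
    refine Finset.sum_le_sum fun i _ => ?_
    simp only [he]
    split_ifs with h
    · exact mul_le_mul_of_nonneg_right (hc1 i) h.le
    · rw [zero_mul]
      exact mul_nonpos_of_nonneg_of_nonpos (hc0 i) (not_lt.1 h)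
  refine hle.trans ?_
  obtain ⟨h01, hrank⟩ := mem_rankOne01.1 hR
  have hrank' : (Matrix.diagonal e * R).rank ≤ 1 :=
    hrank ▸ Matrix.rank_mul_le_right (Matrix.diagonal e) R
  rcases Nat.le_one_iff_eq_zero_or_eq_one.1 hrank' with h | h
  · rw [eq_zero_of_rank_eq_zero h]
    simp [frob]
  · refine hX _ (mem_rankOne01.2 ⟨fun i j => ?_, h⟩)
    simp only [Matrix.diagonal_mul, he]
    split_ifs
    · simpa using h01 i j
    · simp

lemma abs_le_mnorm {m n : Type*} [Fintype m] [Fintype n] (S : Matrix m n ℝ) (i : m) (j : n) :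
    |S i j| ≤ mnorm S :=
  le_ciSup (f := fun p : m × n => |S p.1 p.2|) (Set.finite_range _).bddAbove (i, j)

lemma mnorm_nonneg {m n : Type*} [Fintype m] [Fintype n] (S : Matrix m n ℝ) : 0 ≤ mnorm S :=
  Real.iSup_nonneg fun _ => abs_nonneg _

lemma mnorm_pos {m n : Type*} [Fintype m] [Fintype n] {S : Matrix m n ℝ} {i : m} {j : n}
    (h : S i j ≠ 0) : 0 < mnorm S :=
  (abs_pos.2 h).trans_le (abs_le_mnorm S i j)

lemma bddAbove_frob {m n : Type*} [Fintype m] [Fintype n] {S : Matrix m n ℝ}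
    (hS : ∀ i j, 0 ≤ S i j) :
    BddAbove {t : ℝ | ∃ X : Matrix m n ℝ,
      (∀ R ∈ rankOne01 m n, frob X R ≤ 1) ∧ t = frob S X} := by
  refine ⟨∑ i, ∑ j, S i j, ?_⟩
  rintro _ ⟨X, hX, rfl⟩
  refine Finset.sum_le_sum fun i _ => Finset.sum_le_sum fun j _ => ?_
  have h := hX _ (single_mem_rankOne01 i j)
  have hXij : frob X (Matrix.single i j 1) = X i j := by
    simp [frob, Matrix.single_apply, ite_and]
  exact mul_le_of_le_one_right (hS i j) (hXij ▸ h)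

/-- Scaling the rows of a nonnegative, not identically zero matrix `S` by a positive
diagonal matrix `D` increases the hyperplane separation bound by at most the factor
`‖D‖ ⬝ ‖S‖ / ‖D ⬝ S‖`. -/
theorem hsb_diagonal_mul_le {m n : ℕ}
    (S : Matrix (Fin m) (Fin n) ℝ) (hS : ∀ i j, 0 ≤ S i j) (hS0 : S ≠ 0)
    (d : Fin m → ℝ) (hd : ∀ i, 0 < d i) :
    hsb (Matrix.diagonal d * S) ≤
      hsb S * (mnorm (Matrix.diagonal d) * mnorm S) / mnorm (Matrix.diagonal d * S) := by
  obtain ⟨i₀, j₀, hij⟩ : ∃ i j, S i j ≠ 0 := by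
    by_contra! h
    exact hS0 (Matrix.ext h)
  have hSpos : 0 < mnorm S := mnorm_pos hij
  have hdle : ∀ i, d i ≤ mnorm (Matrix.diagonal d) := fun i => by
    simpa using (le_abs_self _).trans (abs_le_mnorm (Matrix.diagonal d) i i)
  have hDpos : 0 < mnorm (Matrix.diagonal d) := (hd i₀).trans_le (hdle i₀)
  set M := mnorm (Matrix.diagonal d)
  have hsup : sSup {t : ℝ | ∃ X : Matrix (Fin m) (Fin n) ℝ,
        (∀ R ∈ rankOne01 (Fin m) (Fin n), frob X R ≤ 1) ∧
          t = frob (Matrix.diagonal d * S) X} ≤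
      M * sSup {t : ℝ | ∃ X : Matrix (Fin m) (Fin n) ℝ,
        (∀ R ∈ rankOne01 (Fin m) (Fin n), frob X R ≤ 1) ∧ t = frob S X} := by
    refine csSup_le ⟨_, 0, fun R _ => by simp [frob], rfl⟩ ?_
    rintro _ ⟨X, hX, rfl⟩
    have hscale : frob (Matrix.diagonal d * S) X =
        M * frob S (Matrix.diagonal (fun i => d i / M) * X) := by
      simp only [frob, Matrix.diagonal_mul, Finset.mul_sum]
      refine Finset.sum_congr rfl fun i _ => Finset.sum_congr rfl fun j _ => ?_
      field_simp
    rw [hscale]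
    refine mul_le_mul_of_nonneg_left (le_csSup (bddAbove_frob hS) ⟨_, fun R hR => ?_, rfl⟩)
      hDpos.le
    exact frob_diagonal_mul_le_one hX (fun i => div_nonneg (hd i).le hDpos.le)
      (fun i => div_le_one_of_le₀ (hdle i) hDpos.le) hR
  refine (mul_le_mul_of_nonneg_left hsup (inv_nonneg.2 (mnorm_nonneg _))).trans_eq ?_
  rw [hsb, div_eq_mul_inv]
  field_simp
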